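/- arXiv:2601.07679 — 4 statements merged into one kernel-verified Lean document; each statement's English description precedes it below -/
import Mathlib

section
/- Let n, a, b, s, t be integers with a ≥ b + t - 1, b ≥ 2, s ≥ 2, t ≥ 2 and n ≥ a + b. Suppose F ⊆ C([n],a) and G ⊆ C([n],b) are initial (left-shifted) cross-intersecting families with τ(F) = s and τ(G) = t. Then |F| + |G| ≤ Σ_{j=1}^{s} ( C(n-j, a-1) - Σ_{i=0}^{t-j-1} C(b+t-j-1, i) · C(n-b-t+1, a-i-1) ) + C(n-s, b-s) + C(b+t-1, b) - C(b+t-s-1, b-s), where an inner sum with upper limit below its lower limit is empty. -/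
open Finset

/-- Families `F` and `G` are cross-intersecting: every member of `F` meets every member of `G`. -/
def crossInt (F G : Finset (Finset ℕ)) : Prop :=
  ∀ A ∈ F, ∀ B ∈ G, (A ∩ B).Nonempty

/-- The covering number of `F` (as a family of subsets of `[n] = Icc 1 n`) is at least `s`:
every `T ⊆ [n]` meeting all members of `F` has at least `s` elements. -/
def coverGE (n s : ℕ) (F : Finset (Finset ℕ)) : Prop :=
  ∀ T : Finset ℕ, T ⊆ Finset.Icc 1 n → (∀ A ∈ F, (T ∩ A).Nonempty) → s ≤ T.card

/-- The covering number of `F` equals `s`. -/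
def coverEQ (n s : ℕ) (F : Finset (Finset ℕ)) : Prop :=
  coverGE n s F ∧
    ∃ T : Finset ℕ, T ⊆ Finset.Icc 1 n ∧ (∀ A ∈ F, (T ∩ A).Nonempty) ∧ T.card = s

/-- `F` is initial (left-shifted): replacing an element `j` of a member by a smaller `i ∈ [n]`
not in it stays in the family. -/
def initialFam (n : ℕ) (F : Finset (Finset ℕ)) : Prop :=
  ∀ A ∈ F, ∀ i ∈ Finset.Icc 1 n, ∀ j ∈ A, i < j → i ∉ A → insert i (A.erase j) ∈ F

/-- `C(n,a) + ∑_{i=1}^t (-1)^i C(t,i) C(n-ib,a) + t`, the size of `M^t(n,a,b)`. -/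
def MtSize (n a b t : ℕ) : ℤ :=
  (n.choose a : ℤ) +
    (∑ i ∈ Finset.Icc 1 t, (-1 : ℤ) ^ i * (t.choose i : ℤ) * ((n - i * b).choose a : ℤ)) + t

/-- `C(n,a) - ∑_{i=0}^{t-1} C(b+t-1,i) C(n-b-t+1,a-i) + C(b+t-1,b)`, the size of `H^t(n,a,b)`. -/
def HtSize (n a b t : ℕ) : ℤ :=
  (n.choose a : ℤ) -
    (∑ i ∈ Finset.range t, ((b + t - 1).choose i : ℤ) * ((n - b - t + 1).choose (a - i) : ℤ)) +
    ((b + t - 1).choose b : ℤ)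

/-- `∑_{i=1}^s (C(n-i,a-1) + ∑_{j=1}^{t-1} (-1)^j C(t-1,j) C(n-jb-i,a-1)) + C(n-s,b-s) + t - 1`,
the size of `M_s^t(n,a,b)`. -/
def MstSize (n a b s t : ℕ) : ℤ :=
  (∑ i ∈ Finset.Icc 1 s, (((n - i).choose (a - 1) : ℤ) +
      ∑ j ∈ Finset.Icc 1 (t - 1),
        (-1 : ℤ) ^ j * ((t - 1).choose j : ℤ) * ((n - j * b - i).choose (a - 1) : ℤ))) +
    ((n - s).choose (b - s) : ℤ) + (t : ℤ) - 1

/-- `∑_{j=1}^s (C(n-j,a-1) - ∑_{i=0}^{t-j-1} C(b+t-j-1,i) C(n-b-t+1,a-i-1))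
+ C(n-s,b-s) + C(b+t-1,b) - C(b+t-s-1,b-s)`, the size of `H_s^t(n,a,b)`. -/
def HstSize (n a b s t : ℕ) : ℤ :=
  (∑ j ∈ Finset.Icc 1 s, (((n - j).choose (a - 1) : ℤ) -
      ∑ i ∈ Finset.range (t - j),
        ((b + t - j - 1).choose i : ℤ) * ((n - b - t + 1).choose (a - i - 1) : ℤ))) +
    ((n - s).choose (b - s) : ℤ) + ((b + t - 1).choose b : ℤ) -
    ((b + t - s - 1).choose (b - s) : ℤ)

/-- Shifting lemma: an initial family is closed under replacing elements by smaller ones. -/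
lemma initial_shift {n : ℕ} {G : Finset (Finset ℕ)} (hG : initialFam n G) :
    ∀ (d : ℕ) (B B' : Finset ℕ), B ∈ G → B' ⊆ Finset.Icc 1 n → B'.card = B.card →
      (B \ B').card = d → (∀ x ∈ B' \ B, ∀ y ∈ B \ B', x < y) → B' ∈ G := by
  intro d
  induction d with
  | zero =>
    intro B B' hB _ hc hd _
    have h1 : B ⊆ B' := by
      rw [Finset.card_eq_zero, Finset.sdiff_eq_empty_iff_subset] at hd
      exact hd
    have := Finset.eq_of_subset_of_card_le h1 hc.le
    rwa [← this]
  | succ d ih =>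
    intro B B' hB hB' hc hd hlt
    have h2 : (B' \ B).card = d + 1 := by
      rw [← hd]; exact Finset.card_sdiff_comm hc
    obtain ⟨x, hx⟩ : (B' \ B).Nonempty := by
      rw [← Finset.card_pos]; omega
    obtain ⟨y, hy⟩ : (B \ B').Nonempty := by
      rw [← Finset.card_pos]; omega
    have hxy := hlt x hx y hy
    have hx' := Finset.mem_sdiff.1 hx
    have hy' := Finset.mem_sdiff.1 hy
    have hmem := hG B hB x (hB' hx'.1) y hy'.1 hxy hx'.2
    refine ih _ B' hmem hB' ?_ ?_ ?_
    · rw [Finset.card_insert_of_notMem (by simp [hx'.2]), Finset.card_erase_of_mem hy'.1, hc]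
      have : 0 < B.card := Finset.card_pos.2 ⟨y, hy'.1⟩
      omega
    · have : insert x (B.erase y) \ B' = (B \ B').erase y := by
        ext z
        simp only [Finset.mem_sdiff, Finset.mem_insert, Finset.mem_erase]
        constructor
        · rintro ⟨h | h, h3⟩
          · subst h; exact absurd hx'.1 h3
          · exact ⟨h.1, h.2, h3⟩
        · rintro ⟨h1, h2, h3⟩
          exact ⟨Or.inr ⟨h1, h2⟩, h3⟩
      rw [this, Finset.card_erase_of_mem hy, hd]; rfl
    · intro u hu v hv
      simp only [Finset.mem_sdiff, Finset.mem_insert, Finset.mem_erase] at hu hv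
      apply hlt
      · rw [Finset.mem_sdiff]
        refine ⟨hu.1, fun h => hu.2 (Or.inr ⟨?_, h⟩)⟩
        rintro rfl
        exact hy'.2 hu.1
      · rw [Finset.mem_sdiff]
        rcases hv.1 with h | h
        · subst h; exact absurd hx'.1 hv.2
        · exact ⟨h.2, hv.2⟩

lemma initial_shift' {n : ℕ} {G : Finset (Finset ℕ)} (hG : initialFam n G)
    {B B' : Finset ℕ} (hB : B ∈ G) (hB' : B' ⊆ Finset.Icc 1 n) (hc : B'.card = B.card)
    (h : ∀ x ∈ B', x ∉ B → ∀ y ∈ B, y ∉ B' → x < y) : B' ∈ G := by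
  refine initial_shift hG _ B B' hB hB' hc rfl ?_
  intro x hx y hy
  rw [Finset.mem_sdiff] at hx hy
  exact h x hx.1 hx.2 y hy.1 hy.2

/-- The interval `[s]` covers an initial family with covering number `s`. -/
lemma initial_cover {n a s : ℕ} {F : Finset (Finset ℕ)} (hF : F ⊆ (Finset.Icc 1 n).powersetCard a)
    (hFi : initialFam n F) (h : coverEQ n s F) : s ≤ n ∧
    ∀ A ∈ F, ∃ x ∈ A, x ∈ Finset.Icc 1 s := by
  obtain ⟨-, T, hT, hcov, hTs⟩ := h
  have hsn : s ≤ n := by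
    have := Finset.card_le_card hT
    simp at this; omega
  refine ⟨hsn, ?_⟩
  intro A hA
  by_contra! hdis
  obtain ⟨hAn, hAc⟩ := Finset.mem_powersetCard.1 (hF hA)
  have h1 : (A ∩ T).card ≤ (Finset.Icc 1 s \ T).card := by
    have h2 : (Finset.Icc 1 s \ T).card = (T \ Finset.Icc 1 s).card := by
      apply Finset.card_sdiff_comm; simp [hTs]
    rw [h2]
    apply Finset.card_le_card
    intro x hx
    rw [Finset.mem_inter] at hx
    rw [Finset.mem_sdiff]
    exact ⟨hx.2, hdis x hx.1⟩
  obtain ⟨Z, hZ, hZc⟩ := Finset.exists_subset_card_eq h1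
  have hZ' : ∀ z ∈ Z, z ∈ Finset.Icc 1 s ∧ z ∉ T := fun z hz => Finset.mem_sdiff.1 (hZ hz)
  have hmem : (A \ T) ∪ Z ∈ F := by
    refine initial_shift' hFi hA ?_ ?_ ?_
    · intro x hx
      rcases Finset.mem_union.1 hx with hx | hx
      · exact hAn (Finset.mem_sdiff.1 hx).1
      · have := (hZ' x hx).1
        rw [Finset.mem_Icc] at this ⊢
        omega
    · rw [Finset.card_union_of_disjoint, hZc]
      · exact Finset.card_sdiff_add_card_inter A T
      · rw [Finset.disjoint_left]
        intro x hx hxz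
        exact hdis x (Finset.mem_sdiff.1 hx).1 (hZ' x hxz).1
    · intro x hx hxA y hy hyA
      have hxZ : x ∈ Z := by
        rcases Finset.mem_union.1 hx with hx | hx
        · exact absurd (Finset.mem_sdiff.1 hx).1 hxA
        · exact hx
      have h3 := (hZ' x hxZ).1
      have h4 := hdis y hy
      have h5 := hAn hy
      rw [Finset.mem_Icc] at h3 h4 h5
      omega
  obtain ⟨x, hx⟩ := hcov _ hmem
  rw [Finset.mem_inter, Finset.mem_union, Finset.mem_sdiff] at hx
  rcases hx.2 with h | h
  · exact h.2 hx.1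
  · exact (hZ' x h).2 hx.1

/-- An initial `b`-uniform family with covering number `≥ t` contains all `b`-subsets of
`[b+t-1]`. -/
lemma initial_contains {n b t : ℕ} (ht : 1 ≤ t) (hm : b + t - 1 ≤ n) (hb : 1 ≤ b)
    {G : Finset (Finset ℕ)}
    (hG : G ⊆ (Finset.Icc 1 n).powersetCard b) (hGi : initialFam n G) (h : coverGE n t G) :
    ∀ B ∈ (Finset.Icc 1 (b + t - 1)).powersetCard b, B ∈ G := by
  obtain ⟨B0, hB0, hd⟩ : ∃ B0 ∈ G, ∀ x ∈ B0, x ∉ Finset.Icc 1 (t - 1) := by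
    by_contra! hcon
    have := h (Finset.Icc 1 (t - 1)) (by apply Finset.Icc_subset_Icc le_rfl; omega) (by
      intro A hA
      obtain ⟨x, hx, hx'⟩ := hcon A hA
      exact ⟨x, Finset.mem_inter.2 ⟨hx', hx⟩⟩)
    simp at this; omega
  obtain ⟨hB0n, hB0c⟩ := Finset.mem_powersetCard.1 (hG hB0)
  have hI : Finset.Icc t (b + t - 1) ∈ G := by
    refine initial_shift' hGi hB0 ?_ ?_ ?_
    · apply Finset.Icc_subset_Icc <;> omega
    · rw [hB0c]; simp; omega
    · intro x hx _ y hy hy'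
      have h1 := hd y hy
      have h2 := hB0n hy
      rw [Finset.mem_Icc] at hx hy' h1 h2
      omega
  intro B hB
  obtain ⟨hBn, hBc⟩ := Finset.mem_powersetCard.1 hB
  refine initial_shift' hGi hI ?_ ?_ ?_
  · exact hBn.trans (Finset.Icc_subset_Icc le_rfl hm)
  · rw [hBc]; simp; omega
  · intro x hx hx' y hy _
    have := hBn hx
    rw [Finset.mem_Icc] at hx' hy this
    omega

lemma choose_le_aux {M q u : ℕ} (h1 : q ≤ u) (h2 : q + u ≤ M) : M.choose q ≤ M.choose u := by
  have e := Nat.choose_mul (n := M) (k := u) (s := q) h1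
  have h3 : u.choose q ≤ (M - q).choose (u - q) := by
    rw [← Nat.choose_symm h1]
    exact Nat.choose_le_choose _ (by omega)
  have h4 : 0 < (M - q).choose (u - q) := Nat.choose_pos (by omega)
  have h5 : M.choose q * (M - q).choose (u - q) ≤ M.choose u * (M - q).choose (u - q) := by
    rw [← e]; exact Nat.mul_le_mul_left _ h3
  exact Nat.le_of_mul_le_mul_right h5 h4

/-- Normalized matching for the disjointness relation between two uniform levels. -/
lemma norm_match {Y : Finset ℕ} {u v : ℕ} (huv : u + v ≤ Y.card) {U V : Finset (Finset ℕ)}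
    (hU : U ⊆ Y.powersetCard u) (hV : V ⊆ Y.powersetCard v)
    (h : ∀ Q ∈ U, ∀ S ∈ Y.powersetCard v, Disjoint Q S → S ∈ V) :
    U.card * Y.card.choose v ≤ V.card * Y.card.choose u := by
  classical
  have key : U.card * (Y.card - u).choose v ≤ V.card * (Y.card - v).choose u := by
    apply Finset.card_mul_le_card_mul (fun Q S => Disjoint Q S)
    · intro Q hQ
      obtain ⟨hQY, hQc⟩ := Finset.mem_powersetCard.1 (hU hQ)
      have : ((Y \ Q).powersetCard v).card = (Y.card - u).choose v := by
        rw [Finset.card_powersetCard, Finset.card_sdiff_of_subset hQY, hQc]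
      rw [← this]
      apply Finset.card_le_card
      intro S hS
      obtain ⟨hSY, hSc⟩ := Finset.mem_powersetCard.1 hS
      have hdis : Disjoint Q S := (Finset.disjoint_of_subset_left hSY Finset.sdiff_disjoint).symm
      rw [Finset.mem_bipartiteAbove]
      exact ⟨h Q hQ S (Finset.mem_powersetCard.2 ⟨hSY.trans Finset.sdiff_subset, hSc⟩) hdis, hdis⟩
    · intro S hS
      obtain ⟨hSY, hSc⟩ := Finset.mem_powersetCard.1 (hV hS)
      have : ((Y \ S).powersetCard u).card = (Y.card - v).choose u := by
        rw [Finset.card_powersetCard, Finset.card_sdiff_of_subset hSY, hSc]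
      rw [← this]
      apply Finset.card_le_card
      intro Q hQ
      rw [Finset.mem_bipartiteBelow] at hQ
      obtain ⟨hQY, hQc⟩ := Finset.mem_powersetCard.1 (hU hQ.1)
      exact Finset.mem_powersetCard.2 ⟨Finset.subset_sdiff.2 ⟨hQY, hQ.2⟩, hQc⟩
  have e1 := Nat.choose_mul (n := Y.card) (k := u + v) (s := u) (by omega)
  have e2 := Nat.choose_mul (n := Y.card) (k := u + v) (s := v) (by omega)
  rw [Nat.add_sub_cancel_left] at e1
  rw [Nat.add_sub_cancel] at e2
  have e3 : (u + v).choose u = (u + v).choose v := Nat.choose_symm_add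
  have hpos : 0 < (Y.card - u).choose v := Nat.choose_pos (by omega)
  apply Nat.le_of_mul_le_mul_right _ hpos
  calc U.card * Y.card.choose v * (Y.card - u).choose v
      = (U.card * (Y.card - u).choose v) * Y.card.choose v := by ring
    _ ≤ (V.card * (Y.card - v).choose u) * Y.card.choose v := Nat.mul_le_mul_right _ key
    _ = V.card * (Y.card.choose v * (Y.card - v).choose u) := by ring
    _ = V.card * (Y.card.choose u * (Y.card - u).choose v) := by rw [← e1, ← e2, e3]
    _ = _ := by ring

/-- Normalized matching for inclusion. -/
lemma norm_match_sub {Y : Finset ℕ} {u v : ℕ} (hvu : v ≤ u) (hu : u ≤ Y.card)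
    {U V : Finset (Finset ℕ)}
    (hU : U ⊆ Y.powersetCard u) (hV : V ⊆ Y.powersetCard v)
    (h : ∀ Q ∈ U, ∀ S ∈ Y.powersetCard v, S ⊆ Q → S ∈ V) :
    U.card * Y.card.choose v ≤ V.card * Y.card.choose u := by
  classical
  have h1 : (U.image (fun Q => Y \ Q)).card = U.card := by
    apply Finset.card_image_of_injOn
    intro Q hQ Q' hQ' hh
    have a1 := (Finset.mem_powersetCard.1 (hU hQ)).1
    have a2 := (Finset.mem_powersetCard.1 (hU hQ')).1
    have : Y \ (Y \ Q) = Y \ (Y \ Q') := congrArg (fun Z => Y \ Z) hh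
    rwa [Finset.sdiff_sdiff_eq_self a1, Finset.sdiff_sdiff_eq_self a2] at this
  have := norm_match (Y := Y) (u := Y.card - u) (v := v) (by omega)
    (U := U.image (fun Q => Y \ Q)) (V := V) (by
      intro Z hZ
      obtain ⟨Q, hQ, rfl⟩ := Finset.mem_image.1 hZ
      obtain ⟨a1, a2⟩ := Finset.mem_powersetCard.1 (hU hQ)
      rw [Finset.mem_powersetCard, Finset.card_sdiff_of_subset a1, a2]
      exact ⟨Finset.sdiff_subset, rfl⟩) hV (by
      intro Z hZ S hS hd
      obtain ⟨Q, hQ, rfl⟩ := Finset.mem_image.1 hZ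
      refine h Q hQ S hS ?_
      intro x hx
      by_contra hxQ
      exact Finset.disjoint_left.1 hd
        (Finset.mem_sdiff.2 ⟨(Finset.mem_powersetCard.1 hS).1 hx, hxQ⟩) hx)
  rwa [h1, Nat.choose_symm hu] at this

/-- Monotonicity of level sums in the poset of sets not containing `I`. -/
lemma level_mono {X I : Finset ℕ} {k k' : ℕ} (hIX : I ⊆ X) (hkk : k ≤ k') (hX : k + k' < X.card)
    (γ : Finset ℕ → ℚ) (h0 : ∀ P, 0 ≤ γ P)
    (hm : ∀ P P', P' ⊆ X → P'.card = k' → P.card = k → P ⊆ P' → γ P ≤ γ P') :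
    ∑ P ∈ (X.powersetCard k).filter (fun P => ¬ I ⊆ P), γ P ≤
      ∑ P ∈ (X.powersetCard k').filter (fun P => ¬ I ⊆ P), γ P := by
  classical
  set D := (X.powersetCard k).filter (fun P => ¬ I ⊆ P) with hD
  set D' := (X.powersetCard k').filter (fun P => ¬ I ⊆ P) with hD'
  have hup : ∀ P ∈ D, k'.choose k ≤ (D'.filter (fun P' => P ⊆ P')).card := by
    intro P hP
    rw [hD, Finset.mem_filter, Finset.mem_powersetCard] at hP
    obtain ⟨⟨hPX, hPc⟩, hIP⟩ := hP
    obtain ⟨e, heI, heP⟩ := Finset.not_subset.1 hIP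
    have hW : (((X \ P).erase e).powersetCard (k' - k)).card = (X.card - k - 1).choose (k' - k) := by
      rw [Finset.card_powersetCard, Finset.card_erase_of_mem
        (Finset.mem_sdiff.2 ⟨hIX heI, heP⟩), Finset.card_sdiff_of_subset hPX, hPc]
    calc k'.choose k = k'.choose (k' - k) := (Nat.choose_symm hkk).symm
      _ ≤ (X.card - k - 1).choose (k' - k) := Nat.choose_le_choose _ (by omega)
      _ = _ := hW.symm
      _ ≤ _ := by
        apply Finset.card_le_card_of_injOn (fun Z => P ∪ Z)
        · intro Z hZ
          obtain ⟨hZX, hZc⟩ := Finset.mem_powersetCard.1 (Finset.mem_coe.1 hZ)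
          have hZ1 : ∀ z ∈ Z, z ≠ e ∧ z ∈ X ∧ z ∉ P := by
            intro z hz
            have := hZX hz
            simpa using this
          simp only [Finset.coe_filter, Set.mem_ofPred_eq, hD', Finset.mem_filter,
            Finset.mem_powersetCard]
          refine ⟨⟨⟨?_, ?_⟩, ?_⟩, Finset.subset_union_left⟩
          · exact Finset.union_subset hPX (fun z hz => (hZ1 z hz).2.1)
          · rw [Finset.card_union_of_disjoint, hPc, hZc]
            · omega
            · rw [Finset.disjoint_left]; intro z h1 h2; exact (hZ1 z h2).2.2 h1
          · intro hcon
            rcases Finset.mem_union.1 (hcon heI) with h | h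
            · exact heP h
            · exact (hZ1 e h).1 rfl
        · intro Z hZ Z' hZ' hh
          have hd : ∀ Z ∈ (((X \ P).erase e).powersetCard (k' - k)), (P ∪ Z) \ P = Z := by
            intro Z hZ
            obtain ⟨hZX, -⟩ := Finset.mem_powersetCard.1 hZ
            rw [Finset.union_sdiff_left, Finset.sdiff_eq_self_iff_disjoint, Finset.disjoint_left]
            intro z hz
            have := hZX hz
            simp at this
            exact this.2.2
          rw [← hd Z hZ, ← hd Z' hZ']
          exact congrArg (fun W => W \ P) hh
  have hdown : ∀ P' ∈ D', (D.filter (fun P => P ⊆ P')).card ≤ k'.choose k := by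
    intro P' hP'
    rw [hD', Finset.mem_filter, Finset.mem_powersetCard] at hP'
    rw [← hP'.1.2, ← Finset.card_powersetCard]
    apply Finset.card_le_card
    intro P hP
    rw [Finset.mem_filter, hD, Finset.mem_filter, Finset.mem_powersetCard] at hP
    exact Finset.mem_powersetCard.2 ⟨hP.2, hP.1.1.2⟩
  have hpos : (0 : ℚ) < (k'.choose k : ℚ) := by exact_mod_cast Nat.choose_pos hkk
  refine le_of_mul_le_mul_right ?_ hpos
  calc (∑ P ∈ D, γ P) * (k'.choose k : ℚ)
      = ∑ P ∈ D, γ P * (k'.choose k : ℚ) := by rw [Finset.sum_mul]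
    _ ≤ ∑ P ∈ D, ∑ P' ∈ D'.filter (fun P' => P ⊆ P'), γ P := by
        apply Finset.sum_le_sum
        intro P hP
        rw [Finset.sum_const, nsmul_eq_mul, mul_comm]
        exact mul_le_mul_of_nonneg_right (by exact_mod_cast hup P hP) (h0 P)
    _ ≤ ∑ P ∈ D, ∑ P' ∈ D'.filter (fun P' => P ⊆ P'), γ P' := by
        apply Finset.sum_le_sum
        intro P hP
        apply Finset.sum_le_sum
        intro P' hP'
        rw [hD, Finset.mem_filter, Finset.mem_powersetCard] at hP
        rw [Finset.mem_filter, hD', Finset.mem_filter, Finset.mem_powersetCard] at hP'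
        exact hm P P' hP'.1.1.1 hP'.1.1.2 hP.1.2 hP'.2
    _ = ∑ P' ∈ D', ∑ P ∈ D.filter (fun P => P ⊆ P'), γ P' := by
        simp only [Finset.sum_filter]
        rw [Finset.sum_comm]
    _ ≤ ∑ P' ∈ D', γ P' * (k'.choose k : ℚ) := by
        apply Finset.sum_le_sum
        intro P' hP'
        rw [Finset.sum_const, nsmul_eq_mul, mul_comm]
        exact mul_le_mul_of_nonneg_left (by exact_mod_cast hdown P' hP') (h0 P')
    _ = _ := by rw [Finset.sum_mul]

/-- The antisymmetric summation. -/
lemma antisym_sum (b c : ℕ) (hcb : c ≤ b) (Γ x y : ℕ → ℚ) (hΓ0 : Γ 0 = 0) (hΓ : ∀ k, 0 ≤ Γ k)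
    (hmono : ∀ k, 1 ≤ k → k ≤ c - k → Γ k ≤ Γ (c - k))
    (hsym : ∀ k, 1 ≤ k → k < c → x (c - k) = y k ∧ y (c - k) = x k)
    (hle : ∀ k, 1 ≤ k → k < c → k ≤ c - k → y k ≤ x k)
    (hge : ∀ k, c ≤ k → k < b → x k ≤ y k) :
    ∑ k ∈ Finset.range b, Γ k * x k ≤ ∑ k ∈ Finset.range b, Γ k * y k := by
  rw [← sub_nonneg, ← Finset.sum_sub_distrib]
  have hsplit := Finset.sum_range_add_sum_Ico (fun k => Γ k * y k - Γ k * x k) hcb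
  rw [← hsplit]
  have h2 : 0 ≤ ∑ k ∈ Finset.Ico c b, (Γ k * y k - Γ k * x k) := by
    apply Finset.sum_nonneg
    intro k hk
    rw [Finset.mem_Ico] at hk
    have := mul_le_mul_of_nonneg_left (hge k hk.1 hk.2) (hΓ k)
    linarith
  have h1 : 0 ≤ ∑ k ∈ Finset.range c, (Γ k * y k - Γ k * x k) := by
    rcases Nat.eq_zero_or_pos c with hc | hc
    · simp [hc]
    obtain ⟨c, rfl⟩ : ∃ c', c = c' + 1 := ⟨c - 1, by omega⟩
    rw [Finset.sum_range_succ', hΓ0]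
    simp only [zero_mul, sub_zero, add_zero]
    have hfl := Finset.sum_range_reflect (fun k => Γ (k + 1) * y (k + 1) - Γ (k + 1) * x (k + 1)) c
    set A := ∑ k ∈ Finset.range c, (Γ (k + 1) * y (k + 1) - Γ (k + 1) * x (k + 1)) with hA
    have h3 : 0 ≤ A + A := by
      nth_rewrite 1 [← hfl]
      rw [hA, ← Finset.sum_add_distrib]
      apply Finset.sum_nonneg
      intro k hk
      rw [Finset.mem_range] at hk
      have e1 : c - 1 - k + 1 = c + 1 - (k + 1) := by omega
      rw [e1]
      obtain ⟨s1, s2⟩ := hsym (k + 1) (by omega) (by omega)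
      rw [s1, s2]
      rcases le_total (k + 1) (c + 1 - (k + 1)) with hh | hh
      · have m1 := hmono (k + 1) (by omega) hh
        have m2 := hle (k + 1) (by omega) (by omega) hh
        nlinarith
      · have e2 : c + 1 - (c + 1 - (k + 1)) = k + 1 := by omega
        have m1 := hmono (c + 1 - (k + 1)) (by omega) (by omega)
        have m2 := hle (c + 1 - (k + 1)) (by omega) (by omega) (by omega)
        rw [e2] at m1
        rw [s1, s2] at m2
        nlinarith
    linarith
  linarith

lemma count_split {Y1 Y2 : Finset ℕ} (hd : Disjoint Y1 Y2) {i r : ℕ} (hir : i ≤ r) :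
    Y1.card.choose i * Y2.card.choose (r - i) ≤
      (((Y1 ∪ Y2).powersetCard r).filter (fun X => (X ∩ Y1).card = i)).card := by
  classical
  rw [← Finset.card_powersetCard, ← Finset.card_powersetCard, ← Finset.card_product]
  have hd' := Finset.disjoint_left.1 hd
  have e1 : ∀ p ∈ Y1.powersetCard i ×ˢ Y2.powersetCard (r - i), (p.1 ∪ p.2) ∩ Y1 = p.1 ∧
      (p.1 ∪ p.2) ∩ Y2 = p.2 ∧ Disjoint p.1 p.2 := by
    rintro ⟨P, Q⟩ hp
    rw [Finset.mem_product, Finset.mem_powersetCard, Finset.mem_powersetCard] at hp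
    obtain ⟨⟨hP, -⟩, hQ, -⟩ := hp
    simp only at hP hQ ⊢
    refine ⟨?_, ?_, Finset.disjoint_of_subset_left hP (Finset.disjoint_of_subset_right hQ hd)⟩
    · ext x
      simp only [Finset.mem_inter, Finset.mem_union]
      constructor
      · rintro ⟨h | h, h'⟩
        · exact h
        · exact absurd (hQ h) (hd' h')
      · exact fun h => ⟨Or.inl h, hP h⟩
    · ext x
      simp only [Finset.mem_inter, Finset.mem_union]
      constructor
      · rintro ⟨h | h, h'⟩
        · exact absurd h' (hd' (hP h))
        · exact h
      · exact fun h => ⟨Or.inr h, hQ h⟩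
  apply Finset.card_le_card_of_injOn (fun p => p.1 ∪ p.2)
  · intro p hp
    have hp := Finset.mem_coe.1 hp
    obtain ⟨h1, -, h3⟩ := e1 p hp
    rw [Finset.mem_product, Finset.mem_powersetCard, Finset.mem_powersetCard] at hp
    apply Finset.mem_coe.2
    rw [Finset.mem_filter, Finset.mem_powersetCard, h1, Finset.card_union_of_disjoint h3]
    refine ⟨⟨Finset.union_subset_union hp.1.1 hp.2.1, ?_⟩, hp.1.2⟩
    rw [hp.1.2, hp.2.2]; omega
  · intro p hp p' hp' hh
    simp only at hh
    obtain ⟨h1, h2, -⟩ := e1 p hp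
    obtain ⟨h1', h2', -⟩ := e1 p' hp'
    rw [hh] at h1 h2
    have e2 : p.2 = p'.2 := h2.symm.trans h2'
    have e3 : p.1 = p'.1 := h1.symm.trans h1'
    exact Prod.ext e3 e2

/-- Upper bound for the number of `a`-sets meeting `[s]` and having `≥ t` elements in `[b+t-1]`. -/
lemma count_F0 {n a b s t : ℕ} (ht : 2 ≤ t) (hsb : s ≤ b) (hb : 2 ≤ b)
    (habt : b + t ≤ a + 1) (hnab : a + b ≤ n) :
    ((((Finset.Icc 1 n).powersetCard a).filter (fun A => (∃ x ∈ A, x ∈ Finset.Icc 1 s) ∧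
      t ≤ (A ∩ Finset.Icc 1 (b + t - 1)).card)).card : ℤ) ≤
    ∑ j ∈ Finset.Icc 1 s, (((n - j).choose (a - 1) : ℤ) -
      ∑ i ∈ Finset.range (t - j),
        ((b + t - j - 1).choose i : ℤ) * ((n - b - t + 1).choose (a - i - 1) : ℤ)) := by
  classical
  set F0 := ((Finset.Icc 1 n).powersetCard a).filter (fun A => (∃ x ∈ A, x ∈ Finset.Icc 1 s) ∧
      t ≤ (A ∩ Finset.Icc 1 (b + t - 1)).card) with hF0
  have hcov : F0 ⊆ (Finset.Icc 1 s).biUnion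
      (fun j => F0.filter (fun A => j ∈ A ∧ ∀ x ∈ A, j ≤ x)) := by
    intro A hA
    have hA' := hA
    rw [hF0, Finset.mem_filter, Finset.mem_powersetCard] at hA'
    obtain ⟨⟨hAn, -⟩, ⟨x, hx, hxs⟩, -⟩ := hA'
    have hne : A.Nonempty := ⟨x, hx⟩
    rw [Finset.mem_biUnion]
    refine ⟨A.min' hne, ?_, Finset.mem_filter.2 ⟨hA, A.min'_mem hne, fun y hy => A.min'_le y hy⟩⟩
    have h1 := hAn (A.min'_mem hne)
    have h2 := A.min'_le x hx
    rw [Finset.mem_Icc] at *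
    omega
  have h1 : (F0.card : ℤ) ≤ ∑ j ∈ Finset.Icc 1 s,
      ((F0.filter (fun A => j ∈ A ∧ ∀ x ∈ A, j ≤ x)).card : ℤ) := by
    exact_mod_cast (Finset.card_le_card hcov).trans Finset.card_biUnion_le
  refine h1.trans (Finset.sum_le_sum ?_)
  intro j hj
  rw [Finset.mem_Icc] at hj
  set Y1 := Finset.Icc (j + 1) (b + t - 1) with hY1
  set Y2 := Finset.Icc (b + t) n with hY2
  have hY : Y1 ∪ Y2 = Finset.Icc (j + 1) n := by
    ext x; simp only [hY1, hY2, Finset.mem_union, Finset.mem_Icc]; omega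
  have hd : Disjoint Y1 Y2 := by
    rw [Finset.disjoint_left]; intro x; simp only [hY1, hY2, Finset.mem_Icc]; omega
  have hc1 : Y1.card = b + t - j - 1 := by rw [hY1, Nat.card_Icc]; omega
  have hc2 : Y2.card = n - b - t + 1 := by rw [hY2, Nat.card_Icc]; omega
  set W := (Finset.Icc (j + 1) n).powersetCard (a - 1) with hW
  have hWc : W.card = (n - j).choose (a - 1) := by
    rw [hW, Finset.card_powersetCard, Nat.card_Icc]; congr 1; omega
  have hsplit := Finset.card_filter_add_card_filter_not (s := W) (fun X => t - 1 ≤ (X ∩ Y1).card)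
  have hA : (F0.filter (fun A => j ∈ A ∧ ∀ x ∈ A, j ≤ x)).card ≤
      (W.filter (fun X => t - 1 ≤ (X ∩ Y1).card)).card := by
    apply Finset.card_le_card_of_injOn (fun A => A.erase j)
    · intro A hA
      have hA := Finset.mem_coe.1 hA
      rw [Finset.mem_filter, hF0, Finset.mem_filter, Finset.mem_powersetCard] at hA
      obtain ⟨⟨⟨hAn, hAc⟩, -, hAt⟩, hjA, hmin⟩ := hA
      apply Finset.mem_coe.2
      rw [Finset.mem_filter, hW, Finset.mem_powersetCard, Finset.card_erase_of_mem hjA, hAc]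
      refine ⟨⟨?_, rfl⟩, ?_⟩
      · intro x hx
        rw [Finset.mem_erase] at hx
        have h3 := hmin x hx.2
        have h4 := hAn hx.2
        rw [Finset.mem_Icc] at h4 ⊢
        omega
      · have : (A ∩ Finset.Icc 1 (b + t - 1)).erase j ⊆ A.erase j ∩ Y1 := by
          intro x hx
          rw [Finset.mem_erase, Finset.mem_inter, Finset.mem_Icc] at hx
          rw [Finset.mem_inter, Finset.mem_erase, hY1, Finset.mem_Icc]
          have := hmin x hx.2.1
          refine ⟨⟨hx.1, hx.2.1⟩, ?_, hx.2.2.2⟩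
          omega
        have h5 := Finset.card_le_card this
        have h6 := Finset.pred_card_le_card_erase (s := A ∩ Finset.Icc 1 (b + t - 1)) (a := j)
        show t - 1 ≤ (A.erase j ∩ Y1).card
        omega
    · intro A hA A' hA' hh
      have hA := (Finset.mem_filter.1 (Finset.mem_coe.1 hA)).2.1
      have hA' := (Finset.mem_filter.1 (Finset.mem_coe.1 hA')).2.1
      rw [← Finset.insert_erase hA, ← Finset.insert_erase hA']
      exact congrArg (insert j) hh
  have hB : ∑ i ∈ Finset.range (t - j), (b + t - j - 1).choose i * (n - b - t + 1).choose (a - i - 1)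
      ≤ (W.filter (fun X => ¬ t - 1 ≤ (X ∩ Y1).card)).card := by
    calc _ ≤ ∑ i ∈ Finset.range (t - j), (W.filter (fun X => (X ∩ Y1).card = i)).card := by
          apply Finset.sum_le_sum
          intro i hi
          rw [Finset.mem_range] at hi
          have := count_split hd (i := i) (r := a - 1) (by omega)
          rw [hY, hc1, hc2, Nat.sub_right_comm a 1 i] at this
          exact this
      _ = ((Finset.range (t - j)).biUnion (fun i => W.filter (fun X => (X ∩ Y1).card = i))).card := by
          rw [Finset.card_biUnion]
          intro i _ i' _ hne
          show Disjoint _ _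
          rw [Finset.disjoint_left]
          intro X hX hX'
          rw [Finset.mem_filter] at hX hX'
          exact hne (hX.2.symm.trans hX'.2)
      _ ≤ _ := by
          apply Finset.card_le_card
          intro X hX
          rw [Finset.mem_biUnion] at hX
          obtain ⟨i, hi, hX⟩ := hX
          rw [Finset.mem_range] at hi
          rw [Finset.mem_filter] at hX ⊢
          refine ⟨hX.1, ?_⟩
          omega
  have hB' : ∑ i ∈ Finset.range (t - j),
        ((b + t - j - 1).choose i : ℤ) * ((n - b - t + 1).choose (a - i - 1) : ℤ) ≤
      ((W.filter (fun X => ¬ t - 1 ≤ (X ∩ Y1).card)).card : ℤ) := by exact_mod_cast hB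
  rw [hWc] at hsplit
  have hsplit' : ((W.filter (fun X => t - 1 ≤ (X ∩ Y1).card)).card : ℤ) +
      ((W.filter (fun X => ¬ t - 1 ≤ (X ∩ Y1).card)).card : ℤ) = ((n - j).choose (a - 1) : ℤ) := by
    exact_mod_cast hsplit
  have hA' : ((F0.filter (fun A => j ∈ A ∧ ∀ x ∈ A, j ≤ x)).card : ℤ) ≤
      ((W.filter (fun X => t - 1 ≤ (X ∩ Y1).card)).card : ℤ) := by exact_mod_cast hA
  linarith

lemma count_supersets {N s b : ℕ} (hsb : s ≤ b) (hsN : s ≤ N) :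
    (((Finset.Icc 1 N).powersetCard b).filter (fun B => Finset.Icc 1 s ⊆ B)).card =
      (N - s).choose (b - s) := by
  classical
  have h : ((Finset.Icc (s + 1) N).powersetCard (b - s)).card = (N - s).choose (b - s) := by
    rw [Finset.card_powersetCard, Nat.card_Icc]; congr 1; omega
  rw [← h]
  apply Finset.card_nbij' (fun B => B \ Finset.Icc 1 s) (fun B => B ∪ Finset.Icc 1 s)
  · intro B hB
    have hB := Finset.mem_coe.1 hB
    rw [Finset.mem_filter, Finset.mem_powersetCard] at hB
    apply Finset.mem_coe.2
    rw [Finset.mem_powersetCard, Finset.card_sdiff_of_subset hB.2, hB.1.2]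
    refine ⟨?_, by simp⟩
    intro x hx
    rw [Finset.mem_sdiff] at hx
    have := hB.1.1 hx.1
    simp only [Finset.mem_Icc] at *
    omega
  · intro B hB
    have hB := Finset.mem_coe.1 hB
    rw [Finset.mem_powersetCard] at hB
    apply Finset.mem_coe.2
    rw [Finset.mem_filter, Finset.mem_powersetCard, Finset.card_union_of_disjoint]
    · refine ⟨⟨?_, ?_⟩, Finset.subset_union_right⟩
      · apply Finset.union_subset
        · exact hB.1.trans (Finset.Icc_subset_Icc (by omega) le_rfl)
        · exact Finset.Icc_subset_Icc le_rfl hsN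
      · rw [hB.2, Nat.card_Icc]; omega
    · rw [Finset.disjoint_left]
      intro x hx
      have := hB.1 hx
      simp only [Finset.mem_Icc] at *
      omega
  · intro B hB
    have hB := Finset.mem_coe.1 hB
    rw [Finset.mem_filter] at hB
    exact Finset.sdiff_union_of_subset hB.2
  · intro B hB
    have hB := Finset.mem_coe.1 hB
    rw [Finset.mem_powersetCard] at hB
    simp only
    rw [Finset.union_sdiff_right, Finset.sdiff_eq_self_iff_disjoint, Finset.disjoint_left]
    intro x hx
    have := hB.1 hx
    simp only [Finset.mem_Icc] at *
    omega

lemma count_G0 {n b s m : ℕ} (hsb : s ≤ b) (hbm : b ≤ m) (hmn : m ≤ n) :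
    (((((Finset.Icc 1 n).powersetCard b).filter (fun B => Finset.Icc 1 s ⊆ B)) ∪
      (Finset.Icc 1 m).powersetCard b).card : ℤ) =
      ((n - s).choose (b - s) : ℤ) + (m.choose b : ℤ) - ((m - s).choose (b - s) : ℤ) := by
  classical
  have h := Finset.card_union_add_card_inter
    (((Finset.Icc 1 n).powersetCard b).filter (fun B => Finset.Icc 1 s ⊆ B))
    ((Finset.Icc 1 m).powersetCard b)
  have h1 := count_supersets (N := n) hsb (by omega)
  have h2 := count_supersets (N := m) hsb (by omega)
  have h3 : (((Finset.Icc 1 n).powersetCard b).filter (fun B => Finset.Icc 1 s ⊆ B)) ∩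
      ((Finset.Icc 1 m).powersetCard b) =
      ((Finset.Icc 1 m).powersetCard b).filter (fun B => Finset.Icc 1 s ⊆ B) := by
    ext B
    simp only [Finset.mem_inter, Finset.mem_filter, Finset.mem_powersetCard]
    constructor
    · rintro ⟨⟨h1, h2⟩, h3⟩
      exact ⟨h3, h2⟩
    · rintro ⟨h1, h2⟩
      exact ⟨⟨⟨h1.1.trans (Finset.Icc_subset_Icc le_rfl hmn), h1.2⟩, h2⟩, h1⟩
  rw [h3, h1, h2, Finset.card_powersetCard, Nat.card_Icc, Nat.add_sub_cancel] at h
  zify at h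
  linarith

theorem stmt10 (n a b s t : ℕ) (hb : 2 ≤ b) (hs : 2 ≤ s) (ht : 2 ≤ t)
    (habt : b + t ≤ a + 1) (hnab : a + b ≤ n)
    (F G : Finset (Finset ℕ))
    (hF : F ⊆ (Finset.Icc 1 n).powersetCard a)
    (hG : G ⊆ (Finset.Icc 1 n).powersetCard b)
    (hFinit : initialFam n F)
    (hGinit : initialFam n G)
    (hcross : crossInt F G)
    (hFcov : coverEQ n s F)
    (hGcov : coverEQ n t G) :
    (F.card : ℤ) + G.card ≤ HstSize n a b s t := by
  classical
  obtain ⟨hsn, hFs⟩ := initial_cover hF hFinit hFcov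
  obtain ⟨htn, hGt⟩ := initial_cover hG hGinit hGcov
  have hGc := initial_contains (by omega) (by omega) (by omega) hG hGinit hGcov.1
  set m := b + t - 1 with hm
  set X := Finset.Icc 1 m with hX
  set Y := Finset.Icc (m + 1) n with hY
  have hXc : X.card = m := by simp [hX]
  have hYc : Y.card = n - m := by rw [hY, Nat.card_Icc]; omega
  have hXY : ∀ x, x ∈ X → x ∉ Y := by
    intro x; simp only [hX, hY, Finset.mem_Icc]; omega
  have hXYn : ∀ x, x ∈ Finset.Icc 1 n ↔ x ∈ X ∨ x ∈ Y := by
    intro x; simp only [hX, hY, Finset.mem_Icc]; omega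
  -- s ≤ b
  have hsb : s ≤ b := by
    have hb' : b ≤ X.card := by omega
    obtain ⟨B, hBX, hBc⟩ := Finset.exists_subset_card_eq hb'
    have hBG := hGc B (Finset.mem_powersetCard.2 ⟨hBX, hBc⟩)
    have := hFcov.1 B (Finset.mem_powersetCard.1 (hG hBG)).1 (fun A hA => by
      rw [Finset.inter_comm]; exact hcross A hA B hBG)
    omega
  have hsX : Finset.Icc 1 s ⊆ X := Finset.Icc_subset_Icc le_rfl (by omega)
  set F0 := ((Finset.Icc 1 n).powersetCard a).filter (fun A => (∃ x ∈ A, x ∈ Finset.Icc 1 s) ∧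
      t ≤ (A ∩ X).card) with hF0
  set G0 := (((Finset.Icc 1 n).powersetCard b).filter (fun B => Finset.Icc 1 s ⊆ B)) ∪
      X.powersetCard b with hG0
  have hF0c := count_F0 (n := n) (a := a) ht hsb hb habt hnab
  have hG0c := count_G0 (n := n) (b := b) (s := s) (m := m) hsb (by omega) (by omega)
  -- F ⊆ F0
  have hFF0 : F ⊆ F0 := by
    intro A hA
    rw [hF0, Finset.mem_filter]
    refine ⟨hF hA, hFs A hA, ?_⟩
    by_contra hcon
    have h1 : b ≤ (X \ A).card := by
      have := Finset.card_sdiff_add_card_inter X A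
      rw [Finset.inter_comm] at this
      omega
    obtain ⟨B, hBX, hBc⟩ := Finset.exists_subset_card_eq h1
    have hBG := hGc B (Finset.mem_powersetCard.2 ⟨hBX.trans Finset.sdiff_subset, hBc⟩)
    obtain ⟨x, hx⟩ := hcross A hA B hBG
    rw [Finset.mem_inter] at hx
    exact (Finset.mem_sdiff.1 (hBX hx.2)).2 hx.1
  set D := X.powerset.filter (fun P => ¬ Finset.Icc 1 s ⊆ P ∧ P.card < b) with hD
  set g : Finset ℕ → Finset (Finset ℕ) :=
    fun P => (Y.powersetCard (b - P.card)).filter (fun Q => P ∪ Q ∈ G) with hg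
  set h : Finset ℕ → Finset (Finset ℕ) :=
    fun P => (Y.powersetCard (a - m + P.card)).filter (fun S => (X \ P) ∪ S ∉ F) with hh
  have hDmem : ∀ P, P ∈ D ↔ P ⊆ X ∧ ¬ Finset.Icc 1 s ⊆ P ∧ P.card < b := by
    intro P; rw [hD, Finset.mem_filter, Finset.mem_powerset]
  -- upper bound for G
  have hGle : G.card ≤ G0.card + ∑ P ∈ D, (g P).card := by
    have : G ⊆ G0 ∪ D.biUnion (fun P => (g P).image (fun Q => P ∪ Q)) := by
      intro B hB
      obtain ⟨hBn, hBc⟩ := Finset.mem_powersetCard.1 (hG hB)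
      rw [Finset.mem_union]
      by_cases h1 : Finset.Icc 1 s ⊆ B
      · left
        rw [hG0, Finset.mem_union, Finset.mem_filter]
        exact Or.inl ⟨hG hB, h1⟩
      by_cases h2 : B ⊆ X
      · left
        rw [hG0, Finset.mem_union]
        exact Or.inr (Finset.mem_powersetCard.2 ⟨h2, hBc⟩)
      right
      have hun : (B ∩ X) ∪ (B ∩ Y) = B := by
        ext x
        simp only [Finset.mem_union, Finset.mem_inter]
        constructor
        · rintro (h | h) <;> exact h.1
        · intro h
          rcases (hXYn x).1 (hBn h) with h' | h'
          · exact Or.inl ⟨h, h'⟩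
          · exact Or.inr ⟨h, h'⟩
      have hdis : Disjoint (B ∩ X) (B ∩ Y) := by
        rw [Finset.disjoint_left]
        intro x hx hx'
        exact hXY x (Finset.mem_inter.1 hx).2 (Finset.mem_inter.1 hx').2
      have hcd := Finset.card_union_of_disjoint hdis
      rw [hun, hBc] at hcd
      rw [Finset.mem_biUnion]
      refine ⟨B ∩ X, ?_, ?_⟩
      · rw [hDmem]
        refine ⟨Finset.inter_subset_right, fun h => h1 (h.trans Finset.inter_subset_left), ?_⟩
        obtain ⟨x, hx, hxX⟩ := Finset.not_subset.1 h2
        have : 0 < (B ∩ Y).card := Finset.card_pos.2 ⟨x, Finset.mem_inter.2 ⟨hx,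
          ((hXYn x).1 (hBn hx)).resolve_left hxX⟩⟩
        omega
      · rw [Finset.mem_image]
        refine ⟨B ∩ Y, ?_, hun⟩
        rw [hg, Finset.mem_filter, Finset.mem_powersetCard, hun]
        exact ⟨⟨Finset.inter_subset_right, by omega⟩, hB⟩
    refine (Finset.card_le_card this).trans ((Finset.card_union_le _ _).trans ?_)
    gcongr
    refine Finset.card_biUnion_le.trans (Finset.sum_le_sum fun P _ => Finset.card_image_le)
  -- upper bound for F
  have hFle : F.card + ∑ P ∈ D, (h P).card ≤ F0.card := by
    have h1 : ∑ P ∈ D, (h P).card ≤ (F0 \ F).card := by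
      rw [← Finset.card_sigma]
      have e : ∀ p ∈ D.sigma h, ((X \ p.1) ∪ p.2) ∩ X = X \ p.1 ∧
          ((X \ p.1) ∪ p.2) ∩ Y = p.2 ∧ Disjoint (X \ p.1) p.2 ∧ p.2 ⊆ Y := by
        rintro ⟨P, S⟩ hp
        rw [Finset.mem_sigma, hDmem, hh, Finset.mem_filter, Finset.mem_powersetCard] at hp
        obtain ⟨-, ⟨hS, -⟩, -⟩ := hp
        simp only at hS ⊢
        refine ⟨?_, ?_, ?_, hS⟩
        · ext x
          simp only [Finset.mem_inter, Finset.mem_union, Finset.mem_sdiff]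
          constructor
          · rintro ⟨h | h, h'⟩
            · exact h
            · exact absurd (hS h) (hXY x h')
          · exact fun h => ⟨Or.inl h, h.1⟩
        · ext x
          simp only [Finset.mem_inter, Finset.mem_union, Finset.mem_sdiff]
          constructor
          · rintro ⟨h | h, h'⟩
            · exact absurd h' (hXY x h.1)
            · exact h
          · exact fun h => ⟨Or.inr h, hS h⟩
        · rw [Finset.disjoint_left]
          intro x hx hx'
          exact hXY x (Finset.mem_sdiff.1 hx).1 (hS hx')
      apply Finset.card_le_card_of_injOn (fun p => (X \ p.1) ∪ p.2)
      · intro p hp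
        have hp := Finset.mem_coe.1 hp
        obtain ⟨e1, e2, e3, e4⟩ := e p hp
        rw [Finset.mem_sigma, hDmem, hh, Finset.mem_filter, Finset.mem_powersetCard] at hp
        obtain ⟨⟨hPX, hPs, hPb⟩, ⟨-, hSc⟩, hSF⟩ := hp
        have hPc : (X \ p.1).card = m - p.1.card := by
          rw [Finset.card_sdiff_of_subset hPX, hXc]
        apply Finset.mem_coe.2
        rw [Finset.mem_sdiff, hF0, Finset.mem_filter, Finset.mem_powersetCard]
        refine ⟨⟨⟨?_, ?_⟩, ?_, ?_⟩, hSF⟩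
        · intro x hx
          rw [hXYn]
          rcases Finset.mem_union.1 hx with hx | hx
          · exact Or.inl (Finset.mem_sdiff.1 hx).1
          · exact Or.inr (e4 hx)
        · rw [Finset.card_union_of_disjoint e3, hPc, hSc]; omega
        · obtain ⟨x, hx, hxP⟩ := Finset.not_subset.1 hPs
          exact ⟨x, Finset.mem_union_left _ (Finset.mem_sdiff.2 ⟨hsX hx, hxP⟩), hx⟩
        · simp only
          rw [e1, hPc]; omega
      · rintro ⟨P, S⟩ hp ⟨P', S'⟩ hp' hpp
        obtain ⟨e1, e2, -, -⟩ := e _ (Finset.mem_coe.1 hp)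
        obtain ⟨e1', e2', -, -⟩ := e _ (Finset.mem_coe.1 hp')
        have hPX := ((hDmem _).1 (Finset.mem_sigma.1 (Finset.mem_coe.1 hp)).1).1
        have hPX' := ((hDmem _).1 (Finset.mem_sigma.1 (Finset.mem_coe.1 hp')).1).1
        simp only at hpp e1 e2 e1' e2' hPX hPX'
        rw [hpp] at e1 e2
        have h3 : S = S' := e2.symm.trans e2'
        have h4 : X \ P = X \ P' := e1.symm.trans e1'
        have h5 : P = P' := by
          rw [← Finset.sdiff_sdiff_eq_self hPX, h4, Finset.sdiff_sdiff_eq_self hPX']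
        subst h3 h5
        rfl
    rw [Finset.card_sdiff_of_subset hFF0] at h1
    have := Finset.card_le_card hFF0
    omega
  -- the main comparison
  have hmain : ∑ P ∈ D, (g P).card ≤ ∑ P ∈ D, (h P).card := by
    set x : ℕ → ℚ := fun k => ((n - m).choose (b - k) : ℚ) with hx
    set y : ℕ → ℚ := fun k => ((n - m).choose (a - m + k) : ℚ) with hy
    have hxpos : ∀ k, 0 < x k := by
      intro k
      have : 0 < (n - m).choose (b - k) := Nat.choose_pos (by omega)
      simp only [hx]; exact_mod_cast this
    set γ : Finset ℕ → ℚ := fun P => ((g P).card : ℚ) / x P.card with hγ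
    have hγ0 : ∀ P, 0 ≤ γ P := fun P => div_nonneg (by positivity) (hxpos _).le
    have hgx : ∀ P, ((g P).card : ℚ) = γ P * x P.card := fun P => by
      rw [hγ]; field_simp [(hxpos P.card).ne']
    have hhy : ∀ P ∈ D, γ P * y P.card ≤ ((h P).card : ℚ) := by
      intro P hP
      rw [hDmem] at hP
      have h1 := norm_match (Y := Y) (u := b - P.card) (v := a - m + P.card) (by omega)
        (U := g P) (V := h P) (Finset.filter_subset _ _) (Finset.filter_subset _ _) (by
          intro Q hQ S hS hd
          rw [hg, Finset.mem_filter, Finset.mem_powersetCard] at hQ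
          rw [hh, Finset.mem_filter]
          refine ⟨hS, fun hcon => ?_⟩
          have hSY := (Finset.mem_powersetCard.1 hS).1
          obtain ⟨z, hz⟩ := hcross _ hcon _ hQ.2
          rw [Finset.mem_inter, Finset.mem_union, Finset.mem_union, Finset.mem_sdiff] at hz
          rcases hz with ⟨h1 | h1, h2 | h2⟩
          · exact h1.2 h2
          · exact hXY z h1.1 (hQ.1.1 h2)
          · exact hXY z (hP.1 h2) (hSY h1)
          · exact Finset.disjoint_left.1 hd h2 h1)
      rw [hYc] at h1
      have h2 : ((g P).card : ℚ) * y P.card ≤ ((h P).card : ℚ) * x P.card := by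
        simp only [hx, hy]; exact_mod_cast h1
      rw [hγ]
      simp only
      rw [div_mul_eq_mul_div, div_le_iff₀ (hxpos _)]
      exact h2
    have hγm : ∀ P P', P' ⊆ X → P'.card ≤ b → P ⊆ P' → γ P ≤ γ P' := by
      intro P P' hP' hPb hPP
      have hcc := Finset.card_le_card hPP
      have h1 := norm_match_sub (Y := Y) (u := b - P.card) (v := b - P'.card) (by omega) (by omega)
        (U := g P) (V := g P') (Finset.filter_subset _ _) (Finset.filter_subset _ _) (by
          intro Q hQ S hS hd
          rw [hg, Finset.mem_filter, Finset.mem_powersetCard] at hQ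
          rw [hg, Finset.mem_filter]
          refine ⟨hS, ?_⟩
          obtain ⟨hSY, hSc⟩ := Finset.mem_powersetCard.1 hS
          refine initial_shift' hGinit hQ.2 ?_ ?_ ?_
          · intro z hz
            rw [hXYn]
            rcases Finset.mem_union.1 hz with hz | hz
            · exact Or.inl (hP' hz)
            · exact Or.inr (hSY hz)
          · rw [Finset.card_union_of_disjoint, Finset.card_union_of_disjoint, hSc, hQ.1.2]
            · omega
            · rw [Finset.disjoint_left]
              intro z hz hz'
              exact hXY z (hP' (hPP hz)) (hQ.1.1 hz')
            · rw [Finset.disjoint_left]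
              intro z hz hz'
              exact hXY z (hP' hz) (hSY hz')
          · intro z hz hz' w hw hw'
            rw [Finset.mem_union] at hz hz' hw hw'
            have h1 : z ∈ X := by
              rcases hz with h | h
              · exact hP' h
              · exact absurd (Or.inr (hd h)) hz'
            have h2 : w ∈ Y := by
              rcases hw with h | h
              · exact absurd (Or.inl (hPP h)) hw'
              · exact hQ.1.1 h
            rw [hX, Finset.mem_Icc] at h1
            rw [hY, Finset.mem_Icc] at h2
            omega)
      rw [hYc] at h1
      rw [hγ]
      simp only
      rw [div_le_div_iff₀ (hxpos _) (hxpos _)]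
      simp only [hx]; exact_mod_cast h1
    set Γ : ℕ → ℚ := fun k =>
      ∑ P ∈ (X.powersetCard k).filter (fun P => ¬ Finset.Icc 1 s ⊆ P), γ P with hΓ
    have hfib : ∀ f : Finset ℕ → ℚ, ∑ P ∈ D, f P = ∑ k ∈ Finset.range b,
        ∑ P ∈ (X.powersetCard k).filter (fun P => ¬ Finset.Icc 1 s ⊆ P), f P := by
      intro f
      rw [← Finset.sum_fiberwise_of_maps_to (s := D) (t := Finset.range b) (g := Finset.card)
        (fun P hP => Finset.mem_range.2 ((hDmem P).1 hP).2.2)]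
      apply Finset.sum_congr rfl
      intro k hk
      rw [Finset.mem_range] at hk
      apply Finset.sum_congr _ (fun _ _ => rfl)
      ext P
      rw [Finset.mem_filter, hDmem, Finset.mem_filter, Finset.mem_powersetCard]
      constructor
      · rintro ⟨⟨h1, h2, h3⟩, h4⟩
        exact ⟨⟨h1, h4⟩, h2⟩
      · rintro ⟨⟨h1, h4⟩, h2⟩
        exact ⟨⟨h1, h2, by omega⟩, h4⟩
    have hfib' : ∀ z : ℕ → ℚ, ∑ P ∈ D, γ P * z P.card = ∑ k ∈ Finset.range b, Γ k * z k := by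
      intro z
      rw [hfib]
      apply Finset.sum_congr rfl
      intro k _
      rw [hΓ, Finset.sum_mul]
      apply Finset.sum_congr rfl
      intro P hP
      rw [Finset.mem_filter, Finset.mem_powersetCard] at hP
      rw [hP.1.2]
    have hanti : ∑ k ∈ Finset.range b, Γ k * x k ≤ ∑ k ∈ Finset.range b, Γ k * y k := by
      apply antisym_sum b (b + m - a) (by omega) Γ x y
      · rw [hΓ]
        apply Finset.sum_eq_zero
        intro P hP
        rw [Finset.mem_filter, Finset.mem_powersetCard] at hP
        have hP0 : P = ∅ := Finset.card_eq_zero.1 hP.1.2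
        have : g P = ∅ := by
          rw [hg]
          apply Finset.filter_eq_empty_iff.2
          intro Q hQ hQG
          rw [hP0, Finset.empty_union] at hQG
          obtain ⟨z, hz, hzt⟩ := hGt Q hQG
          have h1 := (Finset.mem_powersetCard.1 hQ).1 hz
          rw [hY, Finset.mem_Icc] at h1
          rw [Finset.mem_Icc] at hzt
          omega
        rw [hγ]
        simp [this]
      · intro k
        exact Finset.sum_nonneg fun P _ => hγ0 P
      · intro k h1 h2
        apply level_mono hsX h2 (by omega) γ hγ0
        intro P P' a1 a2 a3 a4
        exact hγm P P' a1 (by omega) a4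
      · intro k h1 h2
        simp only [hx, hy]
        constructor
        · congr 2; omega
        · congr 2; omega
      · intro k h1 h2 h3
        simp only [hx, hy]
        exact_mod_cast choose_le_aux (by omega) (by omega)
      · intro k h1 h2
        simp only [hx, hy]
        exact_mod_cast choose_le_aux (by omega) (by omega)
    have : (∑ P ∈ D, ((g P).card : ℚ)) ≤ ∑ P ∈ D, ((h P).card : ℚ) := by
      calc _ = ∑ P ∈ D, γ P * x P.card := Finset.sum_congr rfl fun P _ => hgx P
        _ = _ := hfib' x
        _ ≤ _ := hanti
        _ = ∑ P ∈ D, γ P * y P.card := (hfib' y).symm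
        _ ≤ _ := Finset.sum_le_sum hhy
    exact_mod_cast this
  have hfin : F.card + G.card ≤ F0.card + G0.card := by omega
  have hfin' : (F.card : ℤ) + G.card ≤ F0.card + G0.card := by exact_mod_cast hfin
  have e1 : b + t - s - 1 = m - s := by omega
  unfold HstSize
  rw [e1]
  linarith
end

section
/- Let n, a, b, t be positive integers with a > b and n ≥ bt, and let B_1, …, B_t be pairwise disjoint b-element subsets of [n]. Then the family M^t(n,a,b) := {B_1, …, B_t} ∪ {A ∈ C([n],a) : A ∩ B_i ≠ ∅ for all 1 ≤ i ≤ t} has cardinality |M^t(n,a,b)| = C(n,a) + Σ_{i=1}^{t} (-1)^i · C(t,i) · C(n-ib, a) + t. -/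
open Finset

theorem stmt11 (n a b t : ℕ) (hn : 1 ≤ n) (hb : 1 ≤ b) (ht : 1 ≤ t)
    (hab : b < a) (hnbt : b * t ≤ n)
    (B : Fin t → Finset ℕ)
    (hBsub : ∀ i, B i ⊆ Finset.Icc 1 n)
    (hBcard : ∀ i, (B i).card = b)
    (hBdisj : ∀ i j, i ≠ j → Disjoint (B i) (B j)) :
    ((Finset.image B Finset.univ ∪
        ((Finset.Icc 1 n).powersetCard a).filter (fun A => ∀ i, (A ∩ B i).Nonempty)).card : ℤ) =
      MtSize n a b t := by
  have hinj : Function.Injective B := by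
    intro i j hij
    by_contra hne
    have h := hBdisj i j hne
    rw [hij, disjoint_self] at h
    have h2 := hBcard j
    rw [h] at h2
    simp at h2
    omega
  have hdisj : Disjoint (Finset.image B Finset.univ)
      (((Finset.Icc 1 n).powersetCard a).filter (fun A => ∀ i, (A ∩ B i).Nonempty)) := by
    rw [Finset.disjoint_left]
    intro A hA hA2
    obtain ⟨i, -, rfl⟩ := Finset.mem_image.1 hA
    have h1 := (Finset.mem_powersetCard.1 (Finset.mem_filter.1 hA2).1).2
    have h2 := hBcard i
    omega
  have hcnt : ∀ S : Finset (Fin t),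
      (∑ A ∈ (Finset.Icc 1 n).powersetCard a,
        ∏ i ∈ S, (if A ∩ B i = ∅ then (1 : ℤ) else 0)) = ((n - S.card * b).choose a : ℤ) := by
    intro S
    have hU : (S.biUnion B).card = S.card * b := by
      rw [Finset.card_biUnion (fun i _ j _ hij => hBdisj i j hij)]
      simp [hBcard]
    have hUsub : S.biUnion B ⊆ Finset.Icc 1 n := Finset.biUnion_subset.2 fun i _ => hBsub i
    have hc : (Finset.Icc 1 n \ S.biUnion B).card = n - S.card * b := by
      rw [Finset.card_sdiff_of_subset hUsub, hU]
      simp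
    rw [← hc, ← Finset.card_powersetCard]
    have he : (Finset.Icc 1 n \ S.biUnion B).powersetCard a =
        ((Finset.Icc 1 n).powersetCard a).filter (fun A => ∀ i ∈ S, A ∩ B i = ∅) := by
      ext A
      simp only [Finset.mem_powersetCard, Finset.mem_filter, Finset.subset_sdiff,
        ← Finset.disjoint_iff_inter_eq_empty, Finset.disjoint_biUnion_right]
      tauto
    rw [he, Finset.card_filter]
    push_cast
    refine Finset.sum_congr rfl fun A _ => ?_
    rw [Finset.prod_ite_zero]
    simp
  have hind : ∀ A : Finset ℕ, (if ∀ i, (A ∩ B i).Nonempty then (1 : ℤ) else 0) =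
      ∑ S ∈ (Finset.univ : Finset (Fin t)).powerset,
        (-1 : ℤ) ^ S.card * ∏ i ∈ S, (if A ∩ B i = ∅ then (1 : ℤ) else 0) := by
    intro A
    have h1 : (if ∀ i, (A ∩ B i).Nonempty then (1 : ℤ) else 0) =
        ∏ i : Fin t, (-(if A ∩ B i = ∅ then (1 : ℤ) else 0) + 1) := by
      have h2 : ∀ i : Fin t, (-(if A ∩ B i = ∅ then (1 : ℤ) else 0) + 1) =
          if (A ∩ B i).Nonempty then 1 else 0 := by
        intro i
        by_cases h : A ∩ B i = ∅
        · simp [h]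
        · simp [h, Finset.nonempty_iff_ne_empty]
      simp only [h2]
      rw [Finset.prod_ite_zero]
      simp
    rw [h1, Finset.prod_add]
    refine Finset.sum_congr rfl fun S _ => ?_
    rw [Finset.prod_neg]
    simp
  rw [Finset.card_union_of_disjoint hdisj, Finset.card_image_of_injective _ hinj,
    Finset.card_filter]
  push_cast
  simp only [hind]
  rw [Finset.sum_comm]
  simp only [← Finset.mul_sum, hcnt]
  rw [Finset.sum_powerset_apply_card
    (fun k => (-1 : ℤ) ^ k * ((n - k * b).choose a : ℤ)) (x := Finset.univ)]
  have hr : Finset.range (t + 1) = insert 0 (Finset.Icc 1 t) := by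
    ext x
    simp
    omega
  simp only [Finset.card_univ, Fintype.card_fin, MtSize]
  rw [hr, Finset.sum_insert (by simp)]
  simp only [nsmul_eq_mul]
  have hs : ∀ i ∈ Finset.Icc 1 t,
      (t.choose i : ℤ) * ((-1 : ℤ) ^ i * ((n - i * b).choose a : ℤ)) =
      (-1 : ℤ) ^ i * (t.choose i : ℤ) * ((n - i * b).choose a : ℤ) := fun i _ => by ring
  rw [Finset.sum_congr rfl hs]
  simp
  ring
end

section
/- Let n, a, b, t be integers with t ≥ 2, b ≥ 2, a ≥ b + t and n > a + b. Then C(n,a) + Σ_{i=1}^{t} (-1)^i · C(t,i) · C(n-ib, a) ≥ C(n,b). -/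
open Finset

/-- Binomial coefficient with integer upper index, zero for negative upper index. -/
def gch (a : ℕ) (m : ℤ) : ℤ := if m < 0 then 0 else (m.toNat.choose a : ℤ)

/-- Iterated backward difference of step `b`. -/
def hdiff (b a : ℕ) : ℕ → ℤ → ℤ
  | 0, m => gch a m
  | t + 1, m => hdiff b a t m - hdiff b a t (m - b)

lemma gch_nat (a m : ℕ) : gch a (m : ℤ) = (m.choose a : ℤ) := by
  simp [gch]

lemma gch_pascal (a : ℕ) (m : ℤ) : gch (a + 1) (m + 1) = gch (a + 1) m + gch a m := by
  rcases lt_or_ge m 0 with h | h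
  · rcases eq_or_ne m (-1) with rfl | h'
    · simp [gch]
    · have h1 : m + 1 < 0 := by omega
      simp [gch, h, h1]
  · obtain ⟨k, rfl⟩ := Int.eq_ofNat_of_zero_le h
    have := gch_nat (a + 1) (k + 1)
    push_cast at this
    rw [this, gch_nat, gch_nat, Nat.choose_succ_succ]
    push_cast
    ring

lemma gch_zero_of_lt (a : ℕ) (m : ℤ) (h : m < a) : gch a m = 0 := by
  unfold gch
  split_ifs with h1
  · rfl
  · rw [Nat.choose_eq_zero_of_lt (by omega)]; rfl

lemma hdiff_pascal (b a t : ℕ) (m : ℤ) :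
    hdiff b (a + 1) t (m + 1) = hdiff b (a + 1) t m + hdiff b a t m := by
  induction t generalizing m with
  | zero => exact gch_pascal a m
  | succ t ih =>
    have h2 := ih (m - b)
    rw [show m - (b : ℤ) + 1 = m + 1 - b by ring] at h2
    simp only [hdiff]
    rw [ih, h2]
    ring

lemma hdiff_zero_of_lt (b a t : ℕ) (m : ℤ) (h : m < a) : hdiff b a t m = 0 := by
  induction t generalizing m with
  | zero => exact gch_zero_of_lt a m h
  | succ t ih => simp only [hdiff]; rw [ih _ h, ih _ (by omega)]; rfl

lemma hdiff_small (b a t : ℕ) (m : ℤ) (h : m < a + b) : hdiff b a t m = gch a m := by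
  induction t with
  | zero => rfl
  | succ t ih => simp only [hdiff]; rw [ih, hdiff_zero_of_lt _ _ _ _ (by omega)]; ring

lemma hdiff_base (b a t : ℕ) (hb : 2 ≤ b) :
    hdiff b a t ((a + b + 1 : ℕ) : ℤ) = ((a + b + 1).choose a : ℤ) - t * (a + 1) := by
  induction t with
  | zero => simp only [hdiff, gch_nat]; simp
  | succ t ih =>
    simp only [hdiff]
    rw [ih, hdiff_small _ _ _ _ (by omega),
      show ((a + b + 1 : ℕ) : ℤ) - b = ((a + 1 : ℕ) : ℤ) by push_cast; ring, gch_nat]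
    simp
    ring

lemma hdiff_telescope (b a t k : ℕ) (m : ℤ) :
    hdiff b (a + 1) t m - hdiff b (a + 1) t (m - k) = ∑ j ∈ range k, hdiff b a t (m - 1 - j) := by
  induction k with
  | zero => simp
  | succ k ih =>
    rw [sum_range_succ, ← ih]
    have := hdiff_pascal b a t (m - 1 - k)
    rw [show m - 1 - (k : ℤ) + 1 = m - k by ring] at this
    rw [this, show m - ((k + 1 : ℕ) : ℤ) = m - 1 - k by push_cast; ring]
    ring

lemma hdiff_nonneg (b a t : ℕ) (h : t ≤ a) (m : ℤ) : 0 ≤ hdiff b a t m := by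
  induction t generalizing a m with
  | zero =>
    simp only [hdiff, gch]
    split_ifs <;> positivity
  | succ t ih =>
    obtain ⟨a, rfl⟩ : ∃ k, a = k + 1 := ⟨a - 1, by omega⟩
    simp only [hdiff]
    rw [hdiff_telescope]
    exact sum_nonneg fun j _ => ih a (by omega) _

lemma hdiff_pos (b a t : ℕ) (hb : 1 ≤ b) (h : t ≤ a) (m : ℤ) (hm : a ≤ m) :
    1 ≤ hdiff b a t m := by
  induction t generalizing a m with
  | zero =>
    obtain ⟨k, rfl⟩ := Int.eq_ofNat_of_zero_le (by omega : 0 ≤ m)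
    simp only [hdiff, gch_nat]
    exact_mod_cast Nat.choose_pos (by omega)
  | succ t ih =>
    obtain ⟨a, rfl⟩ : ∃ k, a = k + 1 := ⟨a - 1, by omega⟩
    simp only [hdiff]
    rw [hdiff_telescope]
    refine le_trans (ih a (by omega) (m - 1 - (0 : ℕ)) (by push_cast at *; omega)) ?_
    exact single_le_sum (f := fun j : ℕ => hdiff b a t (m - 1 - j))
      (fun j _ => hdiff_nonneg b a t (by omega) _) (mem_range.2 hb)

lemma hdiff_step (b a t c d : ℕ)
    (h1 : ((a + 1 + d).choose (c + 1) : ℤ) ≤ hdiff b (a + 1) t ((a + 1 + d : ℕ) : ℤ))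
    (h2 : ((a + (d + 1)).choose c : ℤ) ≤ hdiff b a t ((a + (d + 1) : ℕ) : ℤ)) :
    ((a + 1 + (d + 1)).choose (c + 1) : ℤ) ≤
      hdiff b (a + 1) t ((a + 1 + (d + 1) : ℕ) : ℤ) := by
  have h := hdiff_pascal b a t ((a + 1 + d : ℕ) : ℤ)
  rw [show a + 1 + (d + 1) = (a + 1 + d) + 1 by ring, Nat.choose_succ_succ]
  rw [show a + (d + 1) = a + 1 + d by ring] at h2
  push_cast at *
  rw [h]
  linarith

lemma hdiff_lower (b t c : ℕ) (hc : c < b) : ∀ a d : ℕ, c + t ≤ a → c ≤ d →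
    ((a + d).choose c : ℤ) ≤ hdiff b a t ((a + d : ℕ) : ℤ) := by
  induction c with
  | zero =>
    intro a d h _
    simpa using hdiff_pos b a t (by omega) (by omega) ((a + d : ℕ) : ℤ) (by push_cast; omega)
  | succ c ih =>
    intro a d h hd
    obtain ⟨a, rfl⟩ : ∃ k, a = k + 1 := ⟨a - 1, by omega⟩
    induction d, hd using Nat.le_induction with
    | base =>
      rw [hdiff_small _ _ _ _ (by push_cast; omega), gch_nat,
        ← Nat.choose_symm_add]
    | succ d hd ihd =>
      exact hdiff_step b a t c d ihd (ih (by omega) a (d + 1) (by omega) (by omega))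

lemma choose_aux (a b : ℕ) (hb : 2 ≤ b) (hab : b ≤ a) :
    (b + 1) * (a + 1) ≤ (a + b + 1).choose b := by
  induction b, hb using Nat.le_induction with
  | base =>
    have h : (a + 2 + 1).choose 2 * 2 = (a + 3) * (a + 2) := by
      have := Nat.add_one_mul_choose_eq (a + 2) 1
      simp at this
      linarith
    nlinarith
  | succ b hb ih =>
    have h1 := ih (by omega)
    have h2 : (a + b + 1).choose b ≤ (a + b + 1).choose (b + 1) :=
      Nat.choose_le_succ_of_lt_half_left (by omega)
    rw [show a + (b + 1) + 1 = a + b + 1 + 1 by ring, Nat.choose_succ_succ]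
    nlinarith

lemma hdiff_main (b t : ℕ) (hb : 2 ≤ b) (a d : ℕ) (h : b + t ≤ a) (hd : b + 1 ≤ d) :
    ((a + d).choose b : ℤ) ≤ hdiff b a t ((a + d : ℕ) : ℤ) := by
  induction d, hd using Nat.le_induction with
  | base =>
    have hB := hdiff_base b a t hb
    rw [show a + (b + 1) = a + b + 1 by ring, hB]
    have h1 := choose_aux a b hb (by omega)
    have h2 : (a + b + 1).choose (b + 1) * (b + 1) = (a + b + 1).choose b * (a + 1) := by
      have := Nat.choose_succ_right_eq (a + b + 1) b
      rwa [show a + b + 1 - b = a + 1 by omega] at this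
    have h3 : (a + b + 1).choose a = (a + b + 1).choose (b + 1) :=
      Nat.choose_symm_of_eq_add (by ring)
    rw [h3]
    obtain ⟨e, rfl⟩ := Nat.exists_eq_add_of_le h
    generalize (b + t + e + b + 1).choose (b + 1) = X at *
    generalize (b + t + e + b + 1).choose b = Y at *
    zify at h1 h2
    push_cast at *
    have hpos : (0 : ℤ) < b + 1 := by positivity
    have h4 : (t + e : ℤ) * ((b + 1) * (b + t + e + 1)) ≤ (t + e) * Y :=
      mul_le_mul_of_nonneg_left h1 (by positivity)
    have h5 : (0 : ℤ) ≤ e * ((b + 1) * (b + t + e + 1)) := by positivity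
    have h6 : (0 : ℤ) ≤ (X - t * (b + t + e + 1) - Y) * (b + 1) := by nlinarith
    have := nonneg_of_mul_nonneg_left h6 hpos
    linarith
  | succ d hd ihd =>
    obtain ⟨a, rfl⟩ : ∃ k, a = k + 1 := ⟨a - 1, by omega⟩
    obtain ⟨c, rfl⟩ : ∃ c, b = c + 1 := ⟨b - 1, by omega⟩
    exact hdiff_step (c + 1) a t c d ihd
      (hdiff_lower (c + 1) t c (by omega) a (d + 1) (by omega) (by omega))

lemma hdiff_sum (b a t : ℕ) (m : ℤ) :
    hdiff b a t m = ∑ i ∈ range (t + 1), (t.choose i : ℤ) * ((-1) ^ i * gch a (m - i * b)) := by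
  induction t generalizing m with
  | zero => simp [hdiff]
  | succ t ih =>
    rw [Finset.sum_choose_succ_mul (fun i _ => (-1 : ℤ) ^ i * gch a (m - i * b)) t]
    simp only [hdiff]
    rw [ih, ih, sub_eq_add_neg, ← sum_neg_distrib]
    congr 1
    apply sum_congr rfl
    intro i _
    rw [show m - (b : ℤ) - i * b = m - ((i + 1 : ℕ) : ℤ) * b by push_cast; ring]
    ring

theorem stmt13 (n a b t : ℕ) (ht : 2 ≤ t) (hb : 2 ≤ b) (habt : b + t ≤ a)
    (hnab : a + b < n) :
    (n.choose b : ℤ) ≤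
      (n.choose a : ℤ) +
        ∑ i ∈ Finset.Icc 1 t, (-1 : ℤ) ^ i * (t.choose i : ℤ) * ((n - i * b).choose a : ℤ) := by
  obtain ⟨d, rfl⟩ : ∃ d, n = a + d := ⟨n - a, by omega⟩
  have h := hdiff_main b t hb a d habt (by omega)
  rw [hdiff_sum, sum_range_succ'] at h
  refine h.trans (le_of_eq ?_)
  rw [add_comm]
  congr 1
  · simp only [Nat.choose_zero_right, Nat.cast_zero, Nat.cast_one, zero_mul, sub_zero, pow_zero,
      one_mul, gch_nat]
  · rw [range_eq_Ico, Finset.sum_Ico_add' (fun i : ℕ => (t.choose i : ℤ) *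
      ((-1) ^ i * gch a (((a + d : ℕ) : ℤ) - i * b))) 0 t 1]
    apply sum_congr
    · ext i; simp
    · intro i _
      have : gch a (((a + d : ℕ) : ℤ) - i * b) = ((a + d - i * b).choose a : ℤ) := by
        rcases le_or_gt (i * b) (a + d) with h | h
        · rw [← gch_nat, Nat.cast_sub h]; push_cast; rfl
        · rw [gch_zero_of_lt _ _ (by zify at h; push_cast at *; linarith),
            Nat.choose_eq_zero_of_lt (by omega)]; rfl
      rw [this]
      ring
end

section
/- Let n, b, t be positive integers with n ≥ b + t - 1. If B ⊆ C([n],b) is an initial (left-shifted) family with covering number τ(B) ≥ t, then every b-element subset of [b+t-1] belongs to B, i.e. C([b+t-1], b) ⊆ B. -/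
open Finset

/-- A set dominated by a member of an initial family belongs to the family. -/
theorem mem_of_dominated (n : ℕ) (B : Finset (Finset ℕ)) (hBinit : initialFam n B)
    (C : Finset ℕ) (hC : C ⊆ Finset.Icc 1 n) :
    ∀ (k : ℕ) (A : Finset ℕ), (A \ C).card = k → A ∈ B → A.card = C.card →
      (∀ m, (A.filter (· ≤ m)).card ≤ (C.filter (· ≤ m)).card) → C ∈ B := by
  intro k
  induction k with
  | zero =>
    intro A hk hA hcard _
    have hsub : A ⊆ C := by
      rw [Finset.card_eq_zero] at hk
      exact Finset.sdiff_eq_empty_iff_subset.mp hk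
    rw [← Finset.eq_of_subset_of_card_le hsub hcard.ge]
    exact hA
  | succ k ih =>
    intro A hk hA hcard hdom
    have hne : (A \ C).Nonempty := by
      rw [← Finset.card_pos]; omega
    obtain ⟨j, hj, hjmin⟩ := Finset.exists_min_image (A \ C) id hne
    obtain ⟨hjA, hjC⟩ := Finset.mem_sdiff.mp hj
    -- below `j`, the set `A` lies in `C`
    have hbelow : ∀ x ∈ A, x < j → x ∈ C := by
      intro x hx hxj
      by_contra hxC
      have := hjmin x (Finset.mem_sdiff.mpr ⟨hx, hxC⟩)
      simp only [id] at this
      omega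
    have hex : ∃ i ∈ C, i < j ∧ i ∉ A := by
      by_contra hcon
      push Not at hcon
      have hss : C.filter (· ≤ j) ⊂ A.filter (· ≤ j) := by
        rw [Finset.ssubset_iff_of_subset]
        · exact ⟨j, by simp [hjA], by simp [hjC]⟩
        · intro x hx
          simp only [Finset.mem_filter] at hx ⊢
          have hxj : x ≠ j := fun h => hjC (h ▸ hx.1)
          exact ⟨hcon x hx.1 (by omega), hx.2⟩
      have := Finset.card_lt_card hss
      have := hdom j
      omega
    obtain ⟨i, hiC, hij, hiA⟩ := hex
    have hiE : i ∉ A.erase j := fun h => hiA (Finset.mem_of_mem_erase h)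
    have hpos : 0 < A.card := Finset.card_pos.mpr ⟨j, hjA⟩
    refine ih (insert i (A.erase j)) ?_ (hBinit A hA i (hC hiC) j hjA hij hiA) ?_ ?_
    · have : insert i (A.erase j) \ C = (A \ C).erase j := by
        ext x
        simp only [Finset.mem_sdiff, Finset.mem_insert, Finset.mem_erase]
        constructor
        · rintro ⟨h | h, h2⟩
          · exact absurd (h ▸ hiC) h2
          · exact ⟨h.1, h.2, h2⟩
        · rintro ⟨h, h1, h2⟩
          exact ⟨Or.inr ⟨h, h1⟩, h2⟩
      rw [this, Finset.card_erase_of_mem hj]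
      omega
    · rw [Finset.card_insert_of_notMem hiE, Finset.card_erase_of_mem hjA]
      omega
    · intro m
      by_cases hm : m < j
      · apply Finset.card_le_card
        intro x hx
        simp only [Finset.mem_filter, Finset.mem_insert, Finset.mem_erase] at hx ⊢
        refine ⟨?_, hx.2⟩
        rcases hx.1 with h | h
        · exact h ▸ hiC
        · exact hbelow x h.2 (by omega)
      · refine le_trans (le_of_eq ?_) (hdom m)
        have h1 : (insert i (A.erase j)).filter (· ≤ m)
            = insert i ((A.filter (· ≤ m)).erase j) := by
          ext x
          simp only [Finset.mem_filter, Finset.mem_insert, Finset.mem_erase]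
          constructor
          · rintro ⟨h | h, h2⟩
            · exact Or.inl h
            · exact Or.inr ⟨h.1, h.2, h2⟩
          · rintro (h | h)
            · exact ⟨Or.inl h, by omega⟩
            · exact ⟨Or.inr ⟨h.1, h.2.1⟩, h.2.2⟩
        have hjm : j ∈ A.filter (· ≤ m) := by
          simp only [Finset.mem_filter]
          exact ⟨hjA, by omega⟩
        have hp : 0 < (A.filter (· ≤ m)).card := Finset.card_pos.mpr ⟨j, hjm⟩
        rw [h1, Finset.card_insert_of_notMem, Finset.card_erase_of_mem hjm]
        · omega
        · intro h
          exact hiA (Finset.mem_filter.mp (Finset.mem_of_mem_erase h)).1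

theorem stmt16 (n b t : ℕ) (hn : 1 ≤ n) (hb : 1 ≤ b) (ht : 1 ≤ t)
    (hnbt : b + t - 1 ≤ n)
    (B : Finset (Finset ℕ))
    (hB : B ⊆ (Finset.Icc 1 n).powersetCard b)
    (hBinit : initialFam n B)
    (hBcov : coverGE n t B) :
    (Finset.Icc 1 (b + t - 1)).powersetCard b ⊆ B := by
  intro C hCm
  obtain ⟨hCs, hCc⟩ := Finset.mem_powersetCard.mp hCm
  have hex : ∃ A ∈ B, ¬ (Finset.Icc 1 (t - 1) ∩ A).Nonempty := by
    by_contra hcon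
    push Not at hcon
    have := hBcov (Finset.Icc 1 (t - 1)) (Finset.Icc_subset_Icc_right (by omega)) hcon
    simp only [Nat.card_Icc] at this
    omega
  obtain ⟨A, hA, hAe⟩ := hex
  obtain ⟨hAs, hAc⟩ := Finset.mem_powersetCard.mp (hB hA)
  have hAt : ∀ x ∈ A, t ≤ x := by
    intro x hx
    by_contra hlt
    have h1 := Finset.mem_Icc.mp (hAs hx)
    exact hAe ⟨x, Finset.mem_inter.mpr ⟨Finset.mem_Icc.mpr ⟨h1.1, by omega⟩, hx⟩⟩
  refine mem_of_dominated n B hBinit C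
    (hCs.trans (Finset.Icc_subset_Icc_right hnbt)) _ A rfl hA (by omega) ?_
  intro m
  have h1 : (A.filter (· ≤ m)).card ≤ m + 1 - t := by
    rw [← Nat.card_Icc]
    apply Finset.card_le_card
    intro x hx
    obtain ⟨hx1, hx2⟩ := Finset.mem_filter.mp hx
    exact Finset.mem_Icc.mpr ⟨hAt x hx1, hx2⟩
  have h2 : (A.filter (· ≤ m)).card ≤ b := hAc ▸ Finset.card_filter_le _ _
  have h3 : (C.filter (¬ · ≤ m)).card ≤ b + t - 1 + 1 - (m + 1) := by
    rw [← Nat.card_Icc]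
    apply Finset.card_le_card
    intro x hx
    obtain ⟨hx1, hx2⟩ := Finset.mem_filter.mp hx
    exact Finset.mem_Icc.mpr ⟨by omega, (Finset.mem_Icc.mp (hCs hx1)).2⟩
  have h4 := Finset.card_filter_add_card_filter_not (s := C) (fun x => x ≤ m)
  omega
end
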